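/- Define doubly-indexed sequences of natural numbers ν_{r,s} and ν^{(I)}_{r,s} by: ν_{0,s} = 1 for all s ≥ 0; for r ≥ 1 and s ≥ 0, ν^{(I)}_{r,s} = ∑_{j=0}^{⌊s/r⌋} (ν_{r−1,r})^j · ν_{r−1, s−jr}, and ν_{r,s} = ∑_{j=0}^{⌊s/r⌋} (3 ν_{r−1,r})^j · ν^{(I)}_{r, s−jr}. Then for every r ≥ 2 and every s > 2r one has ν_{r,s} ≤ ν_{r−1,s} + ν_{r,r} · ν_{s−r, s−r}. -/

import Mathlib

/-- The sequence `ν_{r,s}` counting the number of terms generated at step `r`,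
order `s` of the normal form algorithm:
`ν_{0,s} = 1` and, for `r ≥ 1`,
`ν_{r,s} = ∑_{j=0}^{⌊s/r⌋} (3 ν_{r-1,r})^j · ν^{(I)}_{r, s-jr}` where
`ν^{(I)}_{r,s} = ∑_{j=0}^{⌊s/r⌋} (ν_{r-1,r})^j · ν_{r-1, s-jr}`
(the inner sum below is exactly `ν^{(I)}_{r, s-j(r)}`). -/
def nu : ℕ → ℕ → ℕ
  | 0, _ => 1
  | r + 1, s =>
      ∑ j ∈ Finset.range (s / (r + 1) + 1),
        (3 * nu r (r + 1)) ^ j *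
          (∑ i ∈ Finset.range ((s - j * (r + 1)) / (r + 1) + 1),
            (nu r (r + 1)) ^ i * nu r ((s - j * (r + 1)) - i * (r + 1)))

/-- The auxiliary sequence `ν^{(I)}_{r,s}` (for `r ≥ 1`):
`ν^{(I)}_{r,s} = ∑_{j=0}^{⌊s/r⌋} (ν_{r-1,r})^j · ν_{r-1, s-jr}`. -/
def nuI : ℕ → ℕ → ℕ
  | 0, _ => 1
  | r + 1, s =>
      ∑ j ∈ Finset.range (s / (r + 1) + 1),
        (nu r (r + 1)) ^ j * nu r (s - j * (r + 1))

theorem aux_shift (f : ℕ → ℕ) (c n t : ℕ) (hn : 0 < n) :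
    ∑ j ∈ Finset.range ((t + n) / n + 1), c ^ j * f (t + n - j * n)
      = f (t + n) + c * ∑ j ∈ Finset.range (t / n + 1), c ^ j * f (t - j * n) := by
  rw [Nat.add_div_right t hn, Finset.sum_range_succ', Finset.mul_sum, add_comm]
  congr 1
  · simp
  · refine Finset.sum_congr rfl fun j _ => ?_
    have h : t + n - (j + 1) * n = t - j * n := by
      rw [Nat.add_mul, one_mul, Nat.add_sub_add_right]
    rw [h, pow_succ]
    ring

theorem aux_first (f : ℕ → ℕ) (c n t : ℕ) :
    f t ≤ ∑ j ∈ Finset.range (t / n + 1), c ^ j * f (t - j * n) := by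
  rw [Finset.sum_range_succ']
  simp

theorem nu_succ_eq (r s : ℕ) : nu (r + 1) s =
    ∑ j ∈ Finset.range (s / (r + 1) + 1),
      (3 * nu r (r + 1)) ^ j * nuI (r + 1) (s - j * (r + 1)) := by
  simp only [nu, nuI]

theorem nuI_le_nu (r s : ℕ) : nuI (r + 1) s ≤ nu (r + 1) s := by
  rw [nu_succ_eq]
  exact aux_first (nuI (r + 1)) _ _ _

theorem nu_le_nuI (r s : ℕ) : nu r s ≤ nuI (r + 1) s := by
  rw [nuI]
  exact aux_first (nu r) _ _ _

theorem nu_mono (s : ℕ) : Monotone fun r => nu r s :=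
  monotone_nat_of_le_succ fun r => (nu_le_nuI r s).trans (nuI_le_nu r s)

theorem nu_pos (r s : ℕ) : 1 ≤ nu r s := by
  have h := nu_mono s (Nat.zero_le r)
  simpa [nu] using h

theorem nu_step (r t : ℕ) : nu (r + 1) (t + (r + 1)) =
    nuI (r + 1) (t + (r + 1)) + 3 * nu r (r + 1) * nu (r + 1) t := by
  rw [nu_succ_eq, aux_shift (nuI (r + 1)) _ _ _ r.succ_pos, ← nu_succ_eq]

theorem nuI_step (r t : ℕ) : nuI (r + 1) (t + (r + 1)) =
    nu r (t + (r + 1)) + nu r (r + 1) * nuI (r + 1) t := by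
  simp only [nuI]
  exact aux_shift (nu r) _ _ _ r.succ_pos

/-- For every `r ≥ 2` and `s > 2r`:
`ν_{r,s} ≤ ν_{r-1,s} + ν_{r,r} · ν_{s-r,s-r}`. -/
theorem nu_recursive_bound (r s : ℕ) (hr : 2 ≤ r) (hs : 2 * r < s) :
    nu r s ≤ nu (r - 1) s + nu r r * nu (s - r) (s - r) := by
  obtain ⟨q, rfl⟩ : ∃ q, r = q + 1 := ⟨r - 1, by omega⟩
  obtain ⟨t, rfl⟩ : ∃ t, s = t + (q + 1) := ⟨s - (q + 1), by omega⟩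
  rw [Nat.add_sub_cancel, Nat.add_sub_cancel]
  have h1 := nu_step q t
  have h2 := nuI_step q t
  have h3 := nuI_le_nu q t
  have h4 : nu (q + 1) t ≤ nu t t := nu_mono t (by omega)
  have h5 : 4 * nu q (q + 1) ≤ nu (q + 1) (q + 1) := by
    have e := nu_step q 0
    rw [Nat.zero_add] at e
    have e1 := nu_le_nuI q (q + 1)
    have e2 := Nat.mul_le_mul_left (3 * nu q (q + 1)) (nu_pos (q + 1) 0)
    omega
  have h6 := Nat.mul_le_mul_left (nu q (q + 1)) h3
  have h7 := Nat.mul_le_mul h5 h4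
  rw [h1, h2]
  linarith
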